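/- 2251 divides the class number of the compositum ℚ(5^2)·ℚ(2251), where ℚ(5^2) is the unique subfield of degree 25 of ℚ(ζ_{5^3}) (the 2-nd layer of the cyclotomic ℤ_5-extension of ℚ); equivalently, the 2251-class group of ℚ(5^2)·ℚ(2251) is nontrivial. -/

import Mathlib

open NumberField

theorem IsPrimitiveRoot.dvd_absNorm_sub_one {B : Type*} [Field B] [NumberField B] {N : ℕ} [NeZero N]
    {ζ : B} (hζ : IsPrimitiveRoot ζ N) {P : Ideal (𝓞 B)} (hP : P.IsPrime) (hP₀ : P ≠ ⊥)
    (hN : (Ideal.absNorm P).Coprime N) : N ∣ Ideal.absNorm P - 1 := by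
  have : P.IsMaximal := Ring.DimensionLEOne.maximalOfPrime hP₀ hP
  let _ := Ideal.Quotient.field P
  have h1 : Ideal.absNorm P ≠ 1 := Ideal.absNorm_eq_one_iff.not.mpr hP.ne_top
  obtain ⟨u, hu⟩ := (hζ.toInteger_isPrimitiveRoot.idealQuotient_mk h1 hN).isUnit (NeZero.ne N)
  have h := hζ.toInteger_isPrimitiveRoot.idealQuotient_mk h1 hN
  rw [← hu, IsPrimitiveRoot.coe_units_iff] at h
  have h2 := orderOf_dvd_natCard u
  rwa [Nat.card_units, ← h.eq_orderOf] at h2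

theorem IsPrimitiveRoot.absNorm_modEq_one {B : Type*} [Field B] [NumberField B] {N : ℕ} [NeZero N]
    {ζ : B} (hζ : IsPrimitiveRoot ζ N) (I : Ideal (𝓞 B))
    (hN : (Ideal.absNorm I).Coprime N) : Ideal.absNorm I ≡ 1 [MOD N] := by
  induction I using UniqueFactorizationMonoid.induction_on_prime with
  | h₁ =>
    rw [Ideal.zero_eq_bot, Ideal.absNorm_bot, Nat.coprime_zero_left] at hN
    rw [hN]; exact Nat.modEq_one
  | h₂ x hx => rw [Ideal.isUnit_iff.mp hx, Ideal.absNorm_top]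
  | h₃ I P hI hP ih =>
    rw [map_mul] at hN ⊢
    have hP0 : 1 ≤ Ideal.absNorm P :=
      Nat.one_le_iff_ne_zero.mpr (Ideal.absNorm_eq_zero_iff.not.mpr hP.ne_zero)
    have := hζ.dvd_absNorm_sub_one (Ideal.isPrime_of_prime hP) hP.ne_zero hN.coprime_mul_right
    exact ((Nat.modEq_iff_dvd' hP0).mpr this).symm.mul (ih hN.coprime_mul_left)

/-- The norm of a cyclotomic integer that is prime to the conductor is `±1` modulo the
conductor. -/
theorem IsPrimitiveRoot.norm_sq_eq_one {B : Type*} [Field B] [NumberField B] {N : ℕ} [NeZero N]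
    {ζ : B} (hζ : IsPrimitiveRoot ζ N) (x : 𝓞 B)
    (hN : IsUnit ((Algebra.norm ℤ x : ℤ) : ZMod N)) :
    ((Algebra.norm ℤ x : ℤ) : ZMod N) ^ 2 = 1 := by
  have h := hζ.absNorm_modEq_one (Ideal.span {x})
  rw [Ideal.absNorm_span_singleton] at h
  rw [ZMod.coe_int_isUnit_iff_isCoprime, Int.isCoprime_iff_gcd_eq_one] at hN
  have h1 := (ZMod.natCast_eq_natCast_iff _ _ _).mpr (h (by rw [Nat.Coprime, Nat.gcd_comm]; exact hN))
  rw [← Int.cast_pow, ← Int.natAbs_sq, Int.cast_pow, Int.cast_natCast, h1, Nat.cast_one, one_pow]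

theorem IsPrimitiveRoot.eq_resultant_cyclotomic {R A : Type*} [CommRing R] [Field A] [CharZero A]
    [Algebra R A] [FaithfulSMul R A] {N : ℕ} [NeZero N] {ξ : A} (hξ : IsPrimitiveRoot ξ N)
    (h : Polynomial R) {n : ℕ} (hn : h.natDegree ≤ n) {y : R}
    (hy : algebraMap R A y = ∏ ξ' ∈ primitiveRoots N A, Polynomial.aeval ξ' h) :
    y = Polynomial.resultant (Polynomial.cyclotomic N R) h N.totient n := by
  have : Nontrivial R := (algebraMap R A).domain_nontrivial
  apply FaithfulSMul.algebraMap_injective R A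
  have hs : (Polynomial.cyclotomic N A).Splits := by
    rw [Polynomial.cyclotomic_eq_prod_X_sub_primitiveRoots hξ]
    exact Polynomial.Splits.prod fun i _ => Polynomial.Splits.X_sub_C i
  have := Polynomial.resultant_eq_prod_eval (Polynomial.cyclotomic N A)
    (h.map (algebraMap R A)) n (Polynomial.natDegree_map_le.trans hn) hs
  rw [← Polynomial.resultant_map_map, Polynomial.map_cyclotomic, hy,
    ← Polynomial.natDegree_cyclotomic N A, this, Polynomial.cyclotomic.monic,
    one_pow, one_mul, Polynomial.cyclotomic.roots_eq_primitiveRoots_val]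
  simp only [Polynomial.eval_map_algebraMap]
  rfl

theorem IsPrimitiveRoot.algebraMap_norm_aeval {M A : Type*} [Field M] [Field A] [CharZero M]
    [Algebra M A] {N : ℕ} [NeZero N] [IsCyclotomicExtension {N} M A] {ξ : A}
    (hξ : IsPrimitiveRoot ξ N) (hdeg : Module.finrank M A = N.totient)
    (h : Polynomial M) :
    algebraMap M A (Algebra.norm M (Polynomial.aeval ξ h)) =
      ∏ ξ' ∈ primitiveRoots N A, Polynomial.aeval ξ' h := by
  classical
  have : FiniteDimensional M A := IsCyclotomicExtension.finiteDimensional {N} M A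
  have : IsGalois M A := IsCyclotomicExtension.isGalois {N} M A
  rw [Algebra.norm_eq_prod_automorphisms]
  have hinj : Function.Injective fun σ : Gal(A/M) => σ ξ := by
    intro σ τ hστ
    have : (σ : A →ₐ[M] A) = τ := (hξ.powerBasis M).algHom_ext (by simpa using hστ)
    ext x
    exact DFunLike.congr_fun this x
  have himg : Finset.univ.image (fun σ : Gal(A/M) => σ ξ) = primitiveRoots N A := by
    apply Finset.eq_of_subset_of_card_le
    · intro x hx
      obtain ⟨σ, -, rfl⟩ := Finset.mem_image.mp hx
      exact (mem_primitiveRoots (NeZero.pos N)).mpr (hξ.map_of_injective σ.injective)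
    · rw [Finset.card_image_of_injective _ hinj, Finset.card_univ, hξ.card_primitiveRoots,
        ← Nat.card_eq_fintype_card, IsGalois.card_aut_eq_finrank,
        hdeg]
  rw [← himg, Finset.prod_image hinj.injOn]
  simp [← Polynomial.aeval_algHom_apply]

/-- The reduction modulo `N` of a product of conjugates over the primitive `N`-th roots of unity
is `±1` as soon as it is invertible. -/
theorem map_sq_eq_one_of_eq_prod_primitiveRoots {R A : Type*} [CommRing R] [Field A] [CharZero A]
    [Algebra R A] [FaithfulSMul R A] {N : ℕ} [NeZero N] {ξ : A} (hξ : IsPrimitiveRoot ξ N)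
    (φ : R →+* ZMod N) (h : Polynomial R) {y : R}
    (hy : algebraMap R A y = ∏ ξ' ∈ primitiveRoots N A, Polynomial.aeval ξ' h)
    (hu : IsUnit (φ y)) : φ y ^ 2 = 1 := by
  have : NeZero ((N : ℕ) : ℚ) := NeZero.charZero
  have hB : IsCyclotomicExtension {N} ℚ (CyclotomicField N ℚ) :=
    CyclotomicField.isCyclotomicExtension N ℚ
  have hζ := IsCyclotomicExtension.zeta_spec N ℚ (CyclotomicField N ℚ)
  obtain ⟨g, hg⟩ := Polynomial.map_surjective (Int.castRingHom (ZMod N))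
    (ZMod.ringHom_surjective _) (h.map φ)
  let x : 𝓞 (CyclotomicField N ℚ) := Polynomial.aeval hζ.toInteger g
  have hx : algebraMap ℤ (CyclotomicField N ℚ) (Algebra.norm ℤ x) =
      ∏ ξ' ∈ primitiveRoots N (CyclotomicField N ℚ), Polynomial.aeval ξ' g := by
    have := hζ.algebraMap_norm_aeval
      (IsCyclotomicExtension.finrank _ (Polynomial.cyclotomic.irreducible_rat (NeZero.pos N)))
      (g.map (algebraMap ℤ ℚ))
    simp only [Polynomial.aeval_map_algebraMap] at this
    rw [← this, IsScalarTower.algebraMap_apply ℤ ℚ (CyclotomicField N ℚ), eq_intCast (algebraMap ℤ ℚ),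
      Algebra.coe_norm_int]
    congr 2
    exact (Polynomial.aeval_algebraMap_apply (CyclotomicField N ℚ) hζ.toInteger g).symm
  have h1 := hξ.eq_resultant_cyclotomic h (le_max_left _ g.natDegree) hy
  have h2 := hζ.eq_resultant_cyclotomic g (le_max_right h.natDegree _) hx
  have h3 : φ y = ((Algebra.norm ℤ x : ℤ) : ZMod N) := by
    rw [h1, h2, ← eq_intCast (Int.castRingHom (ZMod N)),
      ← Polynomial.resultant_map_map (φ := Int.castRingHom (ZMod N)),
      ← Polynomial.resultant_map_map (φ := φ), hg, Polynomial.map_cyclotomic,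
      Polynomial.map_cyclotomic]
  rw [h3] at hu ⊢
  exact hζ.norm_sq_eq_one x hu

/-- Norms from a cyclotomic field to a subfield over which it is generated by an `N`-th root of
unity are `±1` modulo `N`, under every reduction map, as soon as they are invertible. -/
theorem map_norm_sq_eq_one {M A : Type*} [Field M] [CharZero M] [Field A] [CharZero A] [Algebra M A]
    {N : ℕ} [NeZero N] [IsCyclotomicExtension {N} M A] (hdeg : Module.finrank M A = N.totient)
    {ξ : A} (hξ : IsPrimitiveRoot ξ N) (ζ : 𝓞 M) {ω : 𝓞 A} (hω : Algebra.adjoin ℤ {ω} = ⊤)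
    (hωξ : (ω : A) = algebraMap M A ζ * ξ) (φ : 𝓞 M →+* ZMod N) (x : 𝓞 A)
    (hu : IsUnit (φ (RingOfIntegers.norm M x))) : φ (RingOfIntegers.norm M x) ^ 2 = 1 := by
  have hx : x ∈ Algebra.adjoin ℤ {ω} := hω ▸ Algebra.mem_top
  rw [Algebra.adjoin_singleton_eq_range_aeval] at hx
  obtain ⟨H, rfl⟩ := hx
  let h : Polynomial (𝓞 M) := (H.map (Int.castRingHom (𝓞 M))).comp (Polynomial.C ζ * Polynomial.X)
  refine map_sq_eq_one_of_eq_prod_primitiveRoots hξ φ h ?_ hu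
  have h1 := hξ.algebraMap_norm_aeval hdeg (h.map (algebraMap (𝓞 M) M))
  simp only [Polynomial.aeval_map_algebraMap] at h1
  rw [← h1, IsScalarTower.algebraMap_apply (𝓞 M) M A]
  refine congrArg (algebraMap M A) ((RingOfIntegers.coe_norm M _).trans (congrArg _ ?_))
  have : Polynomial.aeval ξ h = Polynomial.aeval (ω : A) H := by
    simp only [h, Polynomial.aeval_comp, hωξ]
    rw [← algebraMap_int_eq, Polynomial.aeval_map_algebraMap]
    simp [IsScalarTower.algebraMap_apply (𝓞 M) M A]
  exact (Polynomial.aeval_algebraMap_apply A ω H).symm.trans this.symm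

theorem RingOfIntegers.algebraMap_norm_eq_prod {k M : Type*} [Field k] [Field M] [Algebra k M]
    [FiniteDimensional k M] [IsGalois k M] (y : 𝓞 M) :
    algebraMap (𝓞 k) (𝓞 M) (RingOfIntegers.norm k y) =
      ∏ σ : Gal(M/k), RingOfIntegers.mapRingHom σ y := by
  apply RingOfIntegers.coe_injective
  refine (RingOfIntegers.coe_algebraMap_norm k y).trans ?_
  rw [Algebra.norm_eq_prod_automorphisms, map_prod]
  rfl

theorem map_norm_pow_eq_one {k M K A : Type*} [Field k] [CharZero k] [Field M] [CharZero M]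
    [Field K] [CharZero K] [Field A] [CharZero A]
    [Algebra k M] [Algebra k K] [Algebra k A] [Algebra M A] [Algebra K A] [IsScalarTower k M A]
    [IsScalarTower k K A] [FiniteDimensional k A] [IsGalois k M]
    {N : ℕ} [NeZero N] [IsCyclotomicExtension {N} M A] (hdeg : Module.finrank M A = N.totient)
    {ξ : A} (hξ : IsPrimitiveRoot ξ N) (ζ : 𝓞 M) {ω : 𝓞 A} (hω : Algebra.adjoin ℤ {ω} = ⊤)
    (hωξ : (ω : A) = algebraMap M A ζ * ξ) (φ : 𝓞 M →+* ZMod N) (γ : 𝓞 K) {m : ℕ}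
    (hm : m.Coprime N) (hγ : γ ∣ m) :
    φ (algebraMap (𝓞 k) (𝓞 M) (RingOfIntegers.norm k γ)) ^ (2 * Module.finrank K A) = 1 := by
  have : FiniteDimensional k M := FiniteDimensional.left k M A
  have : FiniteDimensional k K := FiniteDimensional.left k K A
  have : FiniteDimensional K A := FiniteDimensional.right k K A
  have : FiniteDimensional M A := FiniteDimensional.right k M A
  let x : 𝓞 A := algebraMap (𝓞 K) (𝓞 A) γ
  have hx : x ∣ m := by simpa [x] using map_dvd (algebraMap (𝓞 K) (𝓞 A)) hγ
  let y : 𝓞 M := RingOfIntegers.norm M x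
  have hy : y ∣ m ^ Module.finrank M A := by
    have := map_dvd (RingOfIntegers.norm M) hx
    rwa [← map_natCast (algebraMap (𝓞 M) (𝓞 A)), RingOfIntegers.norm_algebraMap] at this
  have h1 : RingOfIntegers.norm k γ ^ Module.finrank K A = RingOfIntegers.norm k y := by
    rw [RingOfIntegers.norm_norm, ← map_pow, ← RingOfIntegers.norm_algebraMap (L := A),
      RingOfIntegers.norm_norm]
  rw [mul_comm, pow_mul, ← map_pow φ, ← map_pow (algebraMap _ _), h1, RingOfIntegers.algebraMap_norm_eq_prod,
    map_prod, ← Finset.prod_pow]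
  refine Finset.prod_eq_one fun σ _ => ?_
  refine map_norm_sq_eq_one hdeg hξ ζ hω hωξ (φ.comp (RingOfIntegers.mapRingHom σ)) x ?_
  refine isUnit_of_dvd_unit (map_dvd _ hy) ?_
  simpa using ((ZMod.isUnit_iff_coprime m N).mpr hm).pow _

theorem RingOfIntegers.natCast_dvd_of_dvd_algebraMap {K A : Type*} [Field K] [CharZero K] [Field A]
    [Algebra K A] {r : ℕ} (hr : r ≠ 0) {x : 𝓞 K} (h : (r : 𝓞 A) ∣ algebraMap (𝓞 K) (𝓞 A) x) :
    (r : 𝓞 K) ∣ x := by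
  obtain ⟨y, hy⟩ := h
  have hr' : (r : K) ≠ 0 := Nat.cast_ne_zero.mpr hr
  have h1 : algebraMap K A (x / r) = y := by
    have : algebraMap K A x = r * y := by
      exact (congrArg (algebraMap (𝓞 A) A) hy).trans (by rw [map_mul, map_natCast])
    rw [map_div₀, this, map_natCast, mul_div_cancel_left₀]
    rw [← map_natCast (algebraMap K A)]
    exact (map_ne_zero _).mpr hr'
  have h2 : IsIntegral ℤ ((x : K) / r) := by
    rw [← isIntegral_algebraMap_iff (algebraMap K A).injective, h1]
    exact y.isIntegral_coe
  let z : 𝓞 K := ⟨_, h2⟩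
  refine ⟨z, ?_⟩
  apply RingOfIntegers.coe_injective
  rw [map_mul, map_natCast]
  exact (mul_div_cancel₀ _ hr').symm

/-- A prime whose Frobenius substitution fixes `K` splits completely in `K`. -/
theorem RingOfIntegers.natCast_dvd_pow_sub_self {K A : Type*} [Field K] [CharZero K] [Field A]
    [CharZero A] [Algebra K A] {r : ℕ} (hr : r.Prime) {ω : 𝓞 A} (hω : Algebra.adjoin ℤ {ω} = ⊤)
    (σ : A →ₐ[K] A) (hσ : σ ω = ω ^ r) (x : 𝓞 K) : (r : 𝓞 K) ∣ x ^ r - x := by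
  refine RingOfIntegers.natCast_dvd_of_dvd_algebraMap (A := A) hr.ne_zero ?_
  have := Fact.mk hr
  have hnu : (r : 𝓞 A) ∈ nonunits (𝓞 A) := by
    intro hu
    have h1 : (r : 𝓞 A) ∣ algebraMap (𝓞 ℚ) (𝓞 A) 1 := by rw [map_one]; exact hu.dvd
    have h2 : (r : 𝓞 ℚ) ∣ 1 := RingOfIntegers.natCast_dvd_of_dvd_algebraMap hr.ne_zero h1
    have h3 : (r : ℤ) ∣ 1 := by simpa using map_dvd Rat.ringOfIntegersEquiv h2
    exact hr.one_lt.ne' (Int.natCast_dvd_natCast.mp h3 |> Nat.dvd_one.mp)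
  have := CharP.quotient (𝓞 A) r hnu
  let q := Ideal.Quotient.mk (Ideal.span {(r : 𝓞 A)})
  let f₁ : 𝓞 A →ₐ[ℤ] (𝓞 A ⧸ Ideal.span {(r : 𝓞 A)}) := ((frobenius _ r).comp q).toIntAlgHom
  let f₂ : 𝓞 A →ₐ[ℤ] (𝓞 A ⧸ Ideal.span {(r : 𝓞 A)}) :=
    (q.comp (RingOfIntegers.mapRingHom (σ : A →+* A))).toIntAlgHom
  have h12 : f₁ = f₂ := by
    refine AlgHom.ext_of_adjoin_eq_top hω ?_
    rw [Set.eqOn_singleton]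
    change q ω ^ r = q (RingOfIntegers.mapRingHom (σ : A →+* A) ω)
    rw [← map_pow]
    congr 1
    apply RingOfIntegers.coe_injective
    exact hσ.symm
  rw [← Ideal.mem_span_singleton, ← Ideal.Quotient.eq_zero_iff_mem, map_sub, map_sub, sub_eq_zero,
    map_pow, map_pow]
  refine (DFunLike.congr_fun h12 (algebraMap (𝓞 K) (𝓞 A) x)).trans ?_
  change q _ = q _
  congr 1
  apply RingOfIntegers.coe_injective
  exact σ.commutes x

theorem NumberField.absNorm_le_of_forall_dvd {K : Type*} [Field K] [NumberField K] {r : ℕ}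
    (hr : r.Prime) (hK : ∀ x : 𝓞 K, (r : 𝓞 K) ∣ x ^ r - x) {J : Ideal (𝓞 K)} (hJ : J.IsPrime)
    (hJ₀ : J ≠ ⊥) (hrJ : (r : 𝓞 K) ∈ J) : Ideal.absNorm J ≤ r := by
  have : J.IsMaximal := Ring.DimensionLEOne.maximalOfPrime hJ₀ hJ
  let _ := Ideal.Quotient.field J
  have : Finite (𝓞 K ⧸ J) := Ideal.finiteQuotientOfFreeOfNeBot J hJ₀
  obtain ⟨u, hu⟩ := IsCyclic.exists_generator (α := (𝓞 K ⧸ J)ˣ)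
  have h1 : u ^ (r - 1) = 1 := by
    have h2 : (u : 𝓞 K ⧸ J) ^ r = u := by
      obtain ⟨x, hx⟩ := Ideal.Quotient.mk_surjective (u : 𝓞 K ⧸ J)
      rw [← hx, ← map_pow, ← sub_eq_zero, ← map_sub, Ideal.Quotient.eq_zero_iff_mem]
      exact J.mem_of_dvd (hK x) hrJ
    have h3 : u ^ r = u := by exact_mod_cast h2
    rwa [← mul_eq_right (b := u), ← pow_succ, Nat.sub_add_cancel hr.one_le]
  have h2 := Nat.le_of_dvd (Nat.sub_pos_of_lt hr.one_lt) (orderOf_dvd_of_pow_eq_one h1)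
  rw [orderOf_eq_card_of_forall_mem_zpowers hu, Nat.card_units] at h2
  have : Ideal.absNorm J = Nat.card (𝓞 K ⧸ J) := rfl
  have := hr.one_lt
  omega

theorem NumberField.exists_relNorm_eq {k K : Type*} [Field k] [NumberField k] [Field K]
    [NumberField K] [Algebra k K] {r : ℕ} (hr : r.Prime)
    (hK : ∀ x : 𝓞 K, (r : 𝓞 K) ∣ x ^ r - x) (I : Ideal (𝓞 k)) {a : ℕ}
    (hI : I ∣ Ideal.span {(r : 𝓞 k)} ^ a) : ∃ J : Ideal (𝓞 K), Ideal.relNorm (𝓞 k) J = I := by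
  induction I using UniqueFactorizationMonoid.induction_on_prime with
  | h₁ => exact ⟨⊥, by simp⟩
  | h₂ I hu => exact ⟨1, by rw [map_one, Ideal.isUnit_iff.mp hu, Ideal.one_eq_top]⟩
  | h₃ I Q hI0 hQ ih =>
    obtain ⟨J, hJ⟩ := ih (dvd_of_mul_left_dvd hI)
    have hQr : (r : 𝓞 k) ∈ Q := by
      have := hQ.dvd_of_dvd_pow (dvd_of_mul_right_dvd hI)
      exact (Ideal.span_singleton_le_iff_mem _).mp (Ideal.le_of_dvd this)
    have hQp := Ideal.isPrime_of_prime hQ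
    have : Q.IsMaximal := Ring.DimensionLEOne.maximalOfPrime hQ.ne_zero hQp
    obtain ⟨P, hP, hPQ⟩ := Ideal.exists_maximal_ideal_liesOver_of_isIntegral (S := 𝓞 K) Q
    obtain ⟨s, hs⟩ := Ideal.exists_relNorm_eq_pow_of_isPrime P Q
    have hPr : (r : 𝓞 K) ∈ P := by
      have : algebraMap (𝓞 k) (𝓞 K) r ∈ P := (Ideal.mem_of_liesOver P Q _).mp hQr
      simpa using this
    have hP0 : P ≠ ⊥ := by
      rintro rfl
      exact hr.ne_zero (by exact_mod_cast (Ideal.mem_bot.mp hPr))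
    have h1 := NumberField.absNorm_le_of_forall_dvd hr hK hP.isPrime hP0 hPr
    have h2 : r ≤ Ideal.absNorm Q := by
      have : Finite (𝓞 k ⧸ Q) := Ideal.finiteQuotientOfFreeOfNeBot Q hQ.ne_zero
      have h3 : ((r : ℕ) : 𝓞 k ⧸ Q) = 0 := by
        rw [← map_natCast (Ideal.Quotient.mk Q)]; exact Ideal.Quotient.eq_zero_iff_mem.mpr hQr
      have h4 : addOrderOf (1 : 𝓞 k ⧸ Q) = r := by
        have := Fact.mk hr
        refine addOrderOf_eq_prime (by simpa using h3) ?_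
        have := Ideal.Quotient.nontrivial_iff.mpr hQp.ne_top
        exact one_ne_zero
      have h5 := addOrderOf_dvd_natCard (1 : 𝓞 k ⧸ Q)
      rw [h4] at h5
      have : Ideal.absNorm Q = Nat.card (𝓞 k ⧸ Q) := rfl
      rw [this]
      exact Nat.le_of_dvd Nat.card_pos h5
    have h3 : Ideal.absNorm P = Ideal.absNorm Q ^ s := by
      rw [← Ideal.absNorm_relNorm (𝓞 k), hs, map_pow]
    have h4 : Ideal.absNorm P ≠ 1 := Ideal.absNorm_eq_one_iff.not.mpr hP.ne_top
    have h5 : s = 1 := by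
      have hr1 := hr.one_lt
      rcases s with _ | _ | s
      · simp [h3] at h4
      · rfl
      · exfalso
        have : r ^ (s + 2) ≤ r := (Nat.pow_le_pow_left h2 _).trans (h3 ▸ h1)
        have h6 : r ^ 2 ≤ r ^ (s + 2) := Nat.pow_le_pow_right hr.pos (by omega)
        nlinarith
    refine ⟨P * J, ?_⟩
    rw [map_mul, hs, h5, pow_one, hJ]

theorem NumberField.exists_pow_card_classGroup_eq {k K : Type*} [Field k] [NumberField k] [Field K]
    [NumberField K] [Algebra k K] {r : ℕ} (hr : r.Prime)
    (hK : ∀ x : 𝓞 K, (r : 𝓞 K) ∣ x ^ r - x) (δ : 𝓞 k) {a : ℕ} (hδ : δ ∣ r ^ a) :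
    ∃ (u : (𝓞 k)ˣ) (γ : 𝓞 K) (b : ℕ), γ ∣ ((r ^ b : ℕ) : 𝓞 K) ∧
      δ ^ Nat.card (ClassGroup (𝓞 K)) = u * RingOfIntegers.norm k γ := by
  have hI : Ideal.span {δ} ∣ Ideal.span {(r : 𝓞 k)} ^ a := by
    rw [Ideal.span_singleton_pow]
    exact Ideal.dvd_iff_le.mpr (Ideal.span_singleton_le_span_singleton.mpr hδ)
  obtain ⟨J, hJ⟩ := NumberField.exists_relNorm_eq hr hK _ hI
  set h := Nat.card (ClassGroup (𝓞 K))
  have hr0 : (r : 𝓞 k) ^ a ≠ 0 := pow_ne_zero _ (Nat.cast_ne_zero.mpr hr.ne_zero)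
  have hδ0 : δ ≠ 0 := fun h0 => hr0 (by rwa [h0, zero_dvd_iff] at hδ)
  have hJ0 : J ≠ ⊥ := by
    rintro rfl
    rw [← Ideal.zero_eq_bot, map_zero] at hJ
    exact hδ0 (by simpa using hJ.symm)
  have hJh : (J ^ h).IsPrincipal := by
    have hJ1 : J ∈ nonZeroDivisors (Ideal (𝓞 K)) := mem_nonZeroDivisors_of_ne_zero hJ0
    have := pow_card_eq_one' (x := ClassGroup.mk0 ⟨J, hJ1⟩)
    rw [← map_pow, ClassGroup.mk0_eq_one_iff] at this
    exact this
  obtain ⟨γ, hγ⟩ := (Submodule.isPrincipal_iff _).mp hJh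
  have hnorm : Algebra.intNorm (𝓞 k) (𝓞 K) γ = RingOfIntegers.norm k γ := by
    apply RingOfIntegers.coe_injective
    exact Algebra.algebraMap_intNorm (K := k) (L := K) γ
  have h1 : Ideal.span {RingOfIntegers.norm k γ} = Ideal.span {δ ^ h} := by
    rw [← hnorm, ← Ideal.relNorm_singleton, ← Ideal.submodule_span_eq, ← hγ, map_pow, hJ,
      Ideal.span_singleton_pow]
  obtain ⟨u, hu⟩ := Ideal.span_singleton_eq_span_singleton.mp h1
  obtain ⟨b, -, hb⟩ := (Nat.dvd_prime_pow hr (m := a * Module.finrank ℚ k)).mp (by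
    have h2 : Ideal.absNorm J ∣ Ideal.absNorm (Ideal.span {(r : 𝓞 k)} ^ a) := by
      rw [← Ideal.absNorm_relNorm (𝓞 k), hJ]
      exact map_dvd _ hI
    rwa [map_pow, Ideal.absNorm_span_singleton, ← map_natCast (algebraMap ℤ (𝓞 k)),
      Algebra.norm_algebraMap, RingOfIntegers.rank, Int.natAbs_pow, Int.natAbs_natCast, ← pow_mul,
      mul_comm] at h2 : Ideal.absNorm J ∣ r ^ (a * Module.finrank ℚ k))
  refine ⟨u, γ, b * h, ?_, by rw [← hu, mul_comm]⟩
  rw [← Ideal.mem_span_singleton, ← Ideal.submodule_span_eq, ← hγ, pow_mul, Nat.cast_pow, ← hb]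
  exact Ideal.pow_mem_pow (Ideal.absNorm_mem J) h

theorem Finset.prod_zpow_eq_zpow_sum {ι G : Type*} [CommGroup G] (s : Finset ι) (f : ι → ℤ)
    (g : G) :
    ∏ i ∈ s, g ^ f i = g ^ ∑ i ∈ s, f i := by
  induction s using Finset.cons_induction with
  | empty => simp
  | cons a s ha ih => rw [Finset.prod_cons, Finset.sum_cons, zpow_add, ih]

theorem NumberField.Units.exists_prod_pow_eq_pow {k : Type*} [Field k] [NumberField k]
    (hk : Odd (Module.finrank ℚ k)) {p : ℕ} [hp : Fact p.Prime] (hp2 : Odd p) {ι : Type*} [Fintype ι]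
    (hι : Module.finrank ℚ k ≤ Fintype.card ι) (u : ι → (𝓞 k)ˣ) :
    ∃ n : ι → ℕ, (∃ i, ¬ p ∣ n i) ∧ ∃ v, ∏ i, u i ^ n i = v ^ p := by
  choose ζe hζe using fun i => (NumberField.Units.exist_unique_eq_mul_prod k (u i)).exists
  have hrank : NumberField.Units.rank k < Fintype.card ι := by
    have h1 := NumberField.InfinitePlace.card_add_two_mul_card_eq_rank k
    have h2 := NumberField.InfinitePlace.card_eq_nrRealPlaces_add_nrComplexPlaces k
    have h3 := hk.pos
    unfold NumberField.Units.rank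
    omega
  have hli : ¬ LinearIndependent (ZMod p) fun (i : ι) j => ((ζe i).2 j : ZMod p) := fun h =>
    hrank.not_ge (by simpa using h.fintype_card_le_finrank)
  obtain ⟨c, hc, i₀, hi₀⟩ := Fintype.not_linearIndependent_iff.mp hli
  refine ⟨fun i => (c i).val, ⟨i₀, fun h => hi₀ ?_⟩, ?_⟩
  · rwa [← ZMod.natCast_eq_zero_iff, ZMod.natCast_zmod_val] at h
  have hdvd : ∀ j, (p : ℤ) ∣ ∑ i, (ζe i).2 j * (c i).val := fun j => by
    rw [← ZMod.intCast_zmod_eq_zero_iff_dvd]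
    simpa [mul_comm] using congrFun hc j
  choose f hf using hdvd
  obtain ⟨t, ht⟩ : ∃ t : (𝓞 k)ˣ, ∏ i, ((ζe i).1 : (𝓞 k)ˣ) ^ (c i).val = t ^ p := by
    refine ⟨_, (?_ : _ = (∏ i, ((ζe i).1 : (𝓞 k)ˣ) ^ (c i).val) ^ p)⟩
    have h := NumberField.Units.torsion_eq_one_or_neg_one_of_odd_finrank hk
      (∏ i, (ζe i).1 ^ (c i).val)
    push_cast at h
    rcases h with h | h <;> rw [h]
    · rw [one_pow]
    · rw [hp2.neg_one_pow]
  refine ⟨t * ∏ j, NumberField.Units.fundSystem k j ^ f j, ?_⟩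
  rw [mul_pow, ← ht, Finset.prod_congr rfl fun i _ => congrArg (· ^ (c i).val) (hζe i)]
  simp only [mul_pow, Finset.prod_mul_distrib, ← Finset.prod_pow]
  rw [Finset.prod_comm]
  congr 1
  refine Finset.prod_congr rfl fun j _ => ?_
  simp only [← zpow_natCast, ← zpow_mul]
  rw [Finset.prod_zpow_eq_zpow_sum, hf, mul_comm]

/-- The value at `x` of the polynomial with list of coefficients `l`. -/
def evalList {R : Type*} [CommRing R] (l : List ℤ) (x : R) : R :=
  l.foldr (fun (a : ℤ) y => a + x * y) 0

theorem map_evalList {R S : Type*} [CommRing R] [CommRing S] (f : R →+* S) (l : List ℤ) (x : R) :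
    f (evalList l x) = evalList l (f x) := by
  induction l with
  | nil => simp [evalList]
  | cons a l ih => simpa [evalList] using congrArg _ ih

def addList : List ℤ → List ℤ → List ℤ
  | [], m => m
  | a :: l, [] => a :: l
  | a :: l, b :: m => (a + b) :: addList l m

def mulList : List ℤ → List ℤ → List ℤ
  | [], _ => []
  | a :: l, m => addList (m.map (a * ·)) (0 :: mulList l m)

theorem evalList_addList {R : Type*} [CommRing R] (l m : List ℤ) (x : R) :
    evalList (addList l m) x = evalList l x + evalList m x := by
  induction l generalizing m with
  | nil => simp [evalList, addList]
  | cons a l ih =>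
    cases m with
    | nil => simp [evalList, addList]
    | cons b m =>
      have := ih m
      simp only [evalList, addList, List.foldr_cons] at this ⊢
      rw [this]
      push_cast
      ring

theorem evalList_map_mul {R : Type*} [CommRing R] (a : ℤ) (l : List ℤ) (x : R) :
    evalList (l.map (a * ·)) x = a * evalList l x := by
  induction l with
  | nil => simp [evalList]
  | cons b l ih =>
    simp only [evalList, List.map_cons, List.foldr_cons] at ih ⊢
    rw [ih]
    push_cast
    ring

theorem evalList_mulList {R : Type*} [CommRing R] (l m : List ℤ) (x : R) :
    evalList (mulList l m) x = evalList l x * evalList m x := by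
  induction l with
  | nil => simp [evalList, mulList]
  | cons a l ih =>
    rw [mulList, evalList_addList, evalList_map_mul]
    have h1 : evalList (0 :: mulList l m) x = x * evalList (mulList l m) x := by simp [evalList]
    have h2 : evalList (a :: l) x = a + x * evalList l x := rfl
    rw [h1, h2, ih]
    ring

/-- The subgroup of order four of the units modulo `125`. -/
def quarticRoots : List ℕ := [1, 57, 68, 124]

/-- The residue modulo `R` of the norm from `ℚ(ζ₁₂₅)` to its subfield of degree `25` of the
polynomial with list of coefficients `l`, evaluated at the root of unity `s ^ 2 ^ n`. -/
def normResidue (R s : ℕ) (l : List ℤ) (n : ℕ) : ℕ :=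
  (quarticRoots.map fun a =>
    (l.foldr (fun c y => c + ((s ^ (2 ^ n % 125 * a % 125) % R : ℕ) : ℤ) * y) 0 % R).toNat).prod % R

/-- The multiplicative combination with exponents `e` of the entries of the periodic list `D`,
starting with the `i`-th one. -/
def twistedProd (R : ℕ) (D e : List ℕ) (i : ℕ) : ℕ :=
  ((List.range 25).map fun m => D.getD ((m + i) % 25) 0 ^ e.getD m 0 % R).prod % R

/-- The coefficients of an element of norm `splitPrime` in `ℤ[ζ₁₂₅]`. -/
def elementCoeffs : List ℤ :=
    [1, -1, 0, 0, 0, 0, 0, -1, -1, 0, 0, 0, 0, 0, -1, 0, 0, -1]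

/-- A prime that splits completely in the compositum of the fields of degrees `25` and `2251`. -/
def splitPrime : ℕ := 895626491374686852363545251

def cofactorCoeffs : List ℤ :=
    [311990115944136457247792534, 50533311179843992226021909, 1807321170115534668039580,
    97030039021996022286064062, -37873435057409205331802270, 52189320796383095505997803,
    -48483987163532125159754223, -76240674005076162036058230, 89594600612099154432251930,
    -132902913732625596800076233, -7590708221287599774338978, 35221690804528087845378230,
    -62741562599826923703723111, -195881202319174434340285028, 60425019328354920367819791,
    155965945203622450088099688, -90189811529011146293732648, 178336721483208136665708737,
    218627580188883411630967628, 245104350360083205946660130, 35027637299545745028961830,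
    -214542654753759136311363907, 143632231186700484082805305, 28021463965154065917341889,
    32336991692987294478920770, -29518790648844310062525422, -22888141196622678010467633,
    5045945912815781292547992, 16400356443365885841368418, -96189158599302467620679939,
    -120543721441841197416750348, 77903167067947999347288813, 115568090718916351358654936,
    21387545197716289933085080, -57928437998021003216553646, -5922364887488620691399902,
    286681209564587358224209428, 20718291644814602409785986, -340972899142048918474924183,
    35652566054672790907424187, 209395212828237365204102747, 5582492851513039010055330,
    -71386744239475009119055222, 90294800641698582782606732, 282196526322075127292399790,
    56245442336154696415918824, -229695958631607547413606175, -83804355992822298785744509,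
    151148078756855101559148735, 194989553200320862117403877, -61670011065702311177502822,
    12154364780572533068965415, -45024920600463639947022385, 199081056575224145804948361,
    -19209227655558960398379922, -197193155328269736252044476, 12536990484188788547125075,
    105799743303062793349639068, 147374963684716048538052498, -175475040733179649169530522,
    -134345217429101667870970376, 227574576881045216707708760, 106286575846897416309055047,
    -249920967780668697674872149, -208017834179940541085230599, 240113004433666480528639405,
    157322795202837413385495260, -15086417449922069027560099, 71088079127035052479763778,
    162731155926244309297460724, 230714811051885962283717058, -140633475261219443525126544,
    -158356496651047191795709716, 76141252736465841496019502, 189832156363342311332623355,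
    37146983175666164914835575, -59679051421629171190186023, -99225259662997722712833095,
    105635536680653959286260062, 18141670969545993185251922, -66608989669074340566015108,
    -124413140159044018515914975, 74020280154985496615850597, 174854010531299080017951850,
    -43260053646048198755299961, -79920327443349913155602147, 31887334543276027483116261,
    177996940488770582158792761, -100671481589423390098446008, -203233088196861754223259789,
    93757091892660037814440425, 111303180696032819014834961, 130905319462954831305028490,
    41334946110797767627608503, 85384971810772313990669322, 143932827231729446821361162,
    -67809791430024207699242116, -69040766872001184656124738, -31653688088400545098064288,
    204654764782222688682047613]

def quotientCoeffs : List ℤ :=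
    [-583636375430550395115752717, -261456804764292465021770625, -48725990009728457557982329,
    95222717851880487618024482, -134903474079405227617866332, 90062755853792300837800073,
    -100673307959915220665752026, -339746802785680494124096541, -196688152506805133005504283,
    -274838146694684278126389652, 26474845319226440071633613, -16344204938771129334544584,
    -112279139143328901723296874, -136844973352198480982805497, 69040766872001184656124738,
    31653688088400545098064288, -204654764782222688682047613]

def cyclotomicCoeffs : List ℤ :=
  (List.range 101).map fun i => if i % 25 = 0 then 1 else 0

theorem mulList_elementCoeffs : mulList elementCoeffs cofactorCoeffs =
    addList [(splitPrime : ℤ)] (mulList quotientCoeffs cyclotomicCoeffs) := by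
  decide +kernel

/-- The residues modulo `2251 ^ 2` of the norms of `1 + ζ`, raised to the power `2250`. -/
def unitResidues : List ℕ :=
    [2991580, 2320782, 3675884, 4303913, 1204286, 3205425, 272372, 1249306, 891397, 4092319,
    1409127, 783349, 4108076, 3977518, 3973016, 2543631, 3851462, 3982020, 267870, 1521677,
    1681498, 4949950, 2784488, 1026457, 4803635]

def elementResidues : List ℕ :=
    [1258310, 3558832, 578508, 1364107, 3381003, 4578535, 3187417, 2147455, 3052357, 1472155,
    4936444, 380420, 261117, 1938112, 4769870, 1057971, 1523928, 337651, 3356242, 3896482,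
    2638173, 1321338, 204842, 4015785, 519982]

/-- The powers of an element of order `25` modulo `2251`. -/
def characterValues : List ℕ := (List.range 25).map fun m => 2105 ^ m % 2251

theorem normResidue_unit : ∀ n < 49,
    normResidue (2251 ^ 2) 3550855 [1, 1] n ^ 2250 % 2251 ^ 2 = unitResidues.getD (n % 25) 0 := by
  decide +kernel

theorem normResidue_element : ∀ n < 25,
    normResidue (2251 ^ 2) 3550855 elementCoeffs n ^ 2250 % 2251 ^ 2 =
      elementResidues.getD (n % 25) 0 := by
  decide +kernel

theorem twistedProd_unit : ∀ i < 24, twistedProd (2251 ^ 2) unitResidues characterValues i = 1 := by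
  decide +kernel

theorem twistedProd_element :
    twistedProd (2251 ^ 2) elementResidues characterValues 0 ≠ 1 := by
  decide +kernel

/-- The residues modulo `2251001` of the norms of `1 + ζ`, raised to the power `1000`. -/
def auxResidues : List ℕ :=
    [2064144, 468293, 2232011, 1071284, 1868892, 2174867, 437366, 625923, 925594, 923429,
    758878, 1426794, 2000962, 1552440, 166439, 1242217, 1880150, 2188022, 1408634, 298924,
    844515, 665807, 1936182, 1214132, 1580515]

def auxExponents : List ℕ :=
    [998, 1092, 1916, 1559, 1127, 2181, 2084, 1440, 948, 2204, 1408, 1280, 563, 1444, 414, 938,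
    691, 1226, 914, 1294, 2200, 569, 1895, 386, 0]

def dualExponents (m : ℕ) : List ℕ := (List.range 25).map fun j =>
  (auxExponents.getD ((j + m) % 25) 0 + (2251 - auxExponents.getD ((j + 24) % 25) 0)) % 2251

theorem normResidue_aux : ∀ n < 49,
    normResidue 2251001 1843624 [1, 1] n ^ 1000 % 2251001 = auxResidues.getD (n % 25) 0 := by
  decide +kernel

theorem twistedProd_aux : ∀ m < 24, ∀ i < 24,
    (twistedProd 2251001 auxResidues (dualExponents m) i = 1 ↔ i ≠ m) := by
  decide +kernel

/-- `powMod p a f n` is `a ^ n` modulo `p` for `n < 2 ^ f`, by repeated squaring. -/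
def powMod (p a : ℕ) : ℕ → ℕ → ℕ
  | 0, _ => 1 % p
  | f + 1, n => powMod p a f (n / 2) ^ 2 * a ^ (n % 2) % p

theorem powMod_eq (p a f : ℕ) {n : ℕ} (hn : n < 2 ^ f) : powMod p a f n = a ^ n % p := by
  induction f generalizing n with
  | zero => simp_all [powMod]
  | succ f ih =>
    rw [powMod, ih (by omega), Nat.mul_mod, ← Nat.pow_mod, ← Nat.mul_mod, ← pow_mul, ← pow_add,
      mul_comm, Nat.div_add_mod]

theorem Nat.prime_of_powMod {p : ℕ} (a f : ℕ) (l : List ℕ) (hlp : ∀ q ∈ l, q.Prime)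
    (h : 1 < p ∧ p ≤ 2 ^ f ∧ l.prod = p - 1 ∧ powMod p a f (p - 1) = 1 ∧
      ∀ q ∈ l, powMod p a f ((p - 1) / q) ≠ 1) : p.Prime := by
  obtain ⟨hp, hf, hl, ha, h⟩ := h
  have key {n : ℕ} (hn : n ≤ p - 1) : (a : ZMod p) ^ n = 1 ↔ powMod p a f n = 1 := by
    rw [← Nat.cast_pow, ← Nat.cast_one, ZMod.natCast_eq_natCast_iff', Nat.mod_eq_of_lt hp,
      powMod_eq _ _ _ (by omega)]
  refine lucas_primality p (a : ZMod p) ((key le_rfl).mpr ha) fun q hq hqd => ?_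
  rw [← hl, hq.prime.dvd_prod_iff] at hqd
  obtain ⟨q', hq', hqq⟩ := hqd
  rw [(Nat.prime_dvd_prime_iff_eq hq (hlp q' hq')).mp hqq]
  exact (key (Nat.div_le_self _ _)).not.mpr (h q' hq')

theorem prime_689733526397 : Nat.Prime 689733526397 :=
  Nat.prime_of_powMod 2 40 [2, 2, 179, 1249, 771269] (by norm_num) (by decide +kernel)

theorem prime_1731347845891 : Nat.Prime 1731347845891 :=
  Nat.prime_of_powMod 3 41 [2, 3, 5, 13, 13, 3539, 96493] (by norm_num) (by decide +kernel)

theorem prime_splitPrime : splitPrime.Prime := by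
  refine Nat.prime_of_powMod 3 90 [2, 3, 5, 5, 5, 689733526397, 1731347845891]
    (fun q hq => ?_) (by decide +kernel)
  simp only [List.mem_cons, List.not_mem_nil, or_false] at hq
  rcases hq with rfl | rfl | rfl | rfl | rfl | rfl | rfl
  exacts [Nat.prime_two, Nat.prime_three, Nat.prime_five, Nat.prime_five, Nat.prime_five,
    prime_689733526397, prime_1731347845891]

theorem splitPrime_mod : splitPrime % 125 = 1 := by decide +kernel

theorem splitPrime_pow_mod : splitPrime ^ 2250 % 2251 ^ 2 = 1 := by
  rw [← powMod_eq _ _ 12 (by norm_num)]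
  decide +kernel

theorem IsPrimitiveRoot.prod_autToPow_val {k M R : Type*} [Field k] [Field M] [Algebra k M]
    [CommMonoid R] [IsCyclotomicExtension {125} k M] [FiniteDimensional k M] {ζ : M}
    (hζ : IsPrimitiveRoot ζ 125) (hcard : Fintype.card Gal(M/k) = 4) (F : ℕ → R) :
    ∏ σ : Gal(M/k), F (hζ.autToPow k σ : ZMod 125).val = (quarticRoots.map F).prod := by
  have hinj : Function.Injective fun σ : Gal(M/k) => (hζ.autToPow k σ : ZMod 125).val :=
    (ZMod.val_injective 125).comp (Units.val_injective.comp (hζ.autToPow_injective k))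
  have himage : Finset.univ.image (fun σ : Gal(M/k) => (hζ.autToPow k σ : ZMod 125).val) =
      {1, 57, 68, 124} := by
    refine Finset.eq_of_subset_of_card_le (fun x hx => ?_) ?_
    · obtain ⟨σ, -, rfl⟩ := Finset.mem_image.mp hx
      have h4 : (hζ.autToPow k σ : ZMod 125) ^ 4 = 1 := by
        rw [← Units.val_pow_eq_pow_val, ← map_pow, ← hcard, pow_card_eq_one, map_one,
          Units.val_one]
      have key : ∀ y : ZMod 125, y ^ 4 = 1 → y.val ∈ ({1, 57, 68, 124} : Finset ℕ) := by
        decide +kernel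
      exact key _ h4
    · rw [Finset.card_image_of_injective _ hinj, Finset.card_univ, hcard]
      decide
  rw [← Finset.prod_image (f := F) hinj.injOn, himage]
  simp [quarticRoots]

theorem RingOfIntegers.algebraMap_norm_evalList {k M : Type*} [Field k] [Field M]
    [Algebra k M] [IsCyclotomicExtension {125} k M] [FiniteDimensional k M] [IsGalois k M]
    {ζ : 𝓞 M} (hζ : IsPrimitiveRoot (ζ : M) 125) (hdeg : Module.finrank k M = 4)
    (l : List ℤ) (j : ℕ) :
    algebraMap (𝓞 k) (𝓞 M) (RingOfIntegers.norm k (evalList l (ζ ^ j))) =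
      (quarticRoots.map fun a => evalList l ((ζ ^ a) ^ j)).prod := by
  rw [RingOfIntegers.algebraMap_norm_eq_prod, ← hζ.prod_autToPow_val (k := k)]
  · refine Finset.prod_congr rfl fun σ _ => ?_
    rw [map_evalList, map_pow]
    congr 2
    apply RingOfIntegers.coe_injective
    rw [map_pow]
    exact (hζ.autToPow_spec k σ).symm
  · rw [← hdeg, ← IsGalois.card_aut_eq_finrank k M, Nat.card_eq_fintype_card]

theorem evalList_natCast (R : ℕ) (l : List ℤ) (x : ℕ) :
    evalList l (x : ZMod R) =
      (l.foldr (fun c y => c + ((x % R : ℕ) : ℤ) * y) 0 : ℤ) := by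
  induction l with
  | nil => simp [evalList]
  | cons a l ih => simpa [evalList] using congrArg ((x : ZMod R) * ·) ih

theorem map_norm_evalList_eq_normResidue {k M : Type*} [Field k] [Field M]
    [Algebra k M] [IsCyclotomicExtension {125} k M] [FiniteDimensional k M] [IsGalois k M]
    {ζ : 𝓞 M} (hζ : IsPrimitiveRoot (ζ : M) 125) (hdeg : Module.finrank k M = 4)
    {R s : ℕ} [NeZero R] (hs : (s : ZMod R) ^ 125 = 1) {m : ℕ} (ψ : 𝓞 M →+* ZMod R)
    (hψ : ψ ζ = s ^ 2 ^ m) (l : List ℤ) (i : ℕ) :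
    ψ (algebraMap (𝓞 k) (𝓞 M) (RingOfIntegers.norm k (evalList l (ζ ^ 2 ^ i)))) =
      normResidue R s l (m + i) := by
  rw [RingOfIntegers.algebraMap_norm_evalList hζ hdeg, map_list_prod, List.map_map, normResidue,
    ZMod.natCast_mod, Nat.cast_list_prod, List.map_map]
  congr 1
  refine List.map_congr_left fun a _ => ?_
  have hR : (R : ℤ) ≠ 0 := mod_cast NeZero.ne R
  have h1 : ((ψ ζ ^ a) ^ 2 ^ i) = ((s ^ (2 ^ (m + i) % 125 * a % 125) : ℕ) : ZMod R) := by
    have hmod (n : ℕ) : (s : ZMod R) ^ (n % 125) = s ^ n := by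
      conv_rhs => rw [← Nat.div_add_mod n 125, pow_add, pow_mul, hs, one_pow, one_mul]
    rw [Nat.cast_pow, hmod, pow_mul, hmod, hψ, pow_add, pow_mul]
    simp only [← pow_mul]
    congr 1
    ring
  simp only [Function.comp_apply, map_evalList, map_pow, h1]
  rw [evalList_natCast, ← Int.cast_natCast (R := ZMod R), Int.toNat_of_nonneg (Int.emod_nonneg _ hR),
    ZMod.intCast_mod]

theorem evalList_replicate_zero_append {R : Type*} [CommRing R] (n : ℕ) (l : List ℤ) (x : R) :
    evalList (List.replicate n 0 ++ l) x = x ^ n * evalList l x := by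
  induction n with
  | zero => simp
  | succ n ih =>
    have h : evalList (List.replicate (n + 1) 0 ++ l) x =
        ((0 : ℤ) : R) + x * evalList (List.replicate n 0 ++ l) x := rfl
    rw [h, ih]
    ring

theorem evalList_cyclotomicCoeffs {R : Type*} [CommRing R] (x : R) :
    evalList cyclotomicCoeffs x = ∑ i ∈ Finset.range 5, (x ^ 25) ^ i := by
  let b (l : List ℤ) : List ℤ := 1 :: (List.replicate 24 0 ++ l)
  have hb (l : List ℤ) : evalList (b l) x = 1 + x ^ 25 * evalList l x := by
    have h : evalList (b l) x = ((1 : ℤ) : R) + x * evalList (List.replicate 24 0 ++ l) x := rfl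
    rw [h, evalList_replicate_zero_append]
    push_cast
    ring
  have h : cyclotomicCoeffs = b (b (b (b [1]))) := by decide +kernel
  rw [h, hb, hb, hb, hb]
  simp only [evalList, List.foldr, Finset.sum_range_succ, Finset.sum_range_zero]
  push_cast
  ring

theorem IsPrimitiveRoot.sum_pow_eq_zero {R : Type*} [CommRing R] [IsDomain R] {ζ : R}
    (hζ : IsPrimitiveRoot ζ 125) : ∑ i ∈ Finset.range 5, (ζ ^ 25) ^ i = 0 :=
  (hζ.pow (by norm_num) (by norm_num : 125 = 25 * 5)).geom_sum_eq_zero (by norm_num)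

theorem IsPrimitiveRoot.isUnit_one_add {R : Type*} [CommRing R] [IsDomain R] {η : R} {n : ℕ}
    (hη : IsPrimitiveRoot η n) (hn : Odd n) (h1 : n ≠ 1) : IsUnit (1 + η) := by
  obtain ⟨j, rfl⟩ := hn
  refine IsUnit.of_mul_eq_one (∑ i ∈ Finset.range (j + 1), (η ^ 2) ^ i) ?_
  have h0 : 1 - η ≠ 0 := sub_ne_zero.mpr (hη.ne_one (by omega)).symm
  apply mul_left_cancel₀ h0
  have h2 := mul_neg_geom_sum (η ^ 2) (j + 1)
  have h3 : (η ^ 2) ^ (j + 1) = η := by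
    rw [← pow_mul, show 2 * (j + 1) = 2 * j + 1 + 1 by ring, pow_succ, hη.pow_eq_one, one_mul]
  rw [h3] at h2
  linear_combination h2

theorem RingOfIntegers.exists_ringHom_zmod {M : Type*} [Field M] [NumberField M]
    [IsCyclotomicExtension {125} ℚ M] {ζ : 𝓞 M} (hζ : IsPrimitiveRoot (ζ : M) 125) {R : ℕ}
    (x : ZMod R) (hx : ∑ i ∈ Finset.range 5, (x ^ 25) ^ i = 0) : ∃ ψ : 𝓞 M →+* ZMod R, ψ ζ = x := by
  have hgen : hζ.integralPowerBasis.gen = ζ := by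
    rw [hζ.integralPowerBasis_gen]
    rfl
  have hmin : minpoly ℤ hζ.integralPowerBasis.gen =
      ∑ i ∈ Finset.range 5, (Polynomial.X ^ 25) ^ i := by
    rw [hgen, ← minpoly.algebraMap_eq (RingOfIntegers.coe_injective (K := M)),
      ← Polynomial.cyclotomic_eq_minpoly hζ (by norm_num)]
    exact Polynomial.cyclotomic_prime_pow_eq_geom_sum (n := 2) Nat.prime_five
  refine ⟨(hζ.integralPowerBasis.lift x ?_).toRingHom, ?_⟩
  · rw [hmin]
    simpa using hx
  · have := hζ.integralPowerBasis.lift_gen x (by rw [hmin]; simpa using hx)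
    exact (congrArg _ hgen.symm).trans this

theorem RingOfIntegers.exists_ringHom_zmod_pow {M : Type*} [Field M] [NumberField M]
    [IsCyclotomicExtension {125} ℚ M] {ζ : 𝓞 M} (hζ : IsPrimitiveRoot (ζ : M) 125) {R s : ℕ}
    (hs : (∑ i ∈ Finset.range 5, s ^ (25 * i)) % R = 0) (m : ℕ) :
    ∃ ψ : 𝓞 M →+* ZMod R, ψ ζ = s ^ 2 ^ m := by
  obtain ⟨ψ, hψ⟩ := RingOfIntegers.exists_ringHom_zmod hζ (s : ZMod R) (by
    have := (ZMod.natCast_eq_zero_iff _ R).mpr (Nat.dvd_of_mod_eq_zero hs)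
    simpa [pow_mul] using this)
  have hζ' : IsPrimitiveRoot ζ 125 := hζ.of_map_of_injective RingOfIntegers.coe_injective
  have hζm : IsPrimitiveRoot (ζ ^ 2 ^ m) 125 :=
    hζ'.pow_of_coprime _ (Nat.Coprime.pow_left _ (by norm_num))
  refine RingOfIntegers.exists_ringHom_zmod hζ _ ?_
  have := congrArg ψ hζm.sum_pow_eq_zero
  simpa [hψ] using this

/-- The multiplicative combination with exponents `E * e` of a family of reductions. -/
noncomputable def twistedHom {k M : Type*} [Field k] [Field M] [Algebra k M] {R : ℕ}
    (ψ : ℕ → 𝓞 M →+* ZMod R) (E : ℕ) (e : List ℕ) : 𝓞 k →* ZMod R :=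
  ((List.range 25).map fun m =>
    (((ψ m).comp (algebraMap (𝓞 k) (𝓞 M)) : 𝓞 k →+* ZMod R) : 𝓞 k →* ZMod R) ^
      (E * e.getD m 0)).prod

theorem twistedHom_apply {k M : Type*} [Field k] [Field M] [Algebra k M] {R : ℕ}
    (ψ : ℕ → 𝓞 M →+* ZMod R) (E : ℕ) (e : List ℕ) (y : 𝓞 k) :
    twistedHom ψ E e y = ((List.range 25).map fun m =>
      (ψ m (algebraMap (𝓞 k) (𝓞 M) y) ^ E) ^ e.getD m 0).prod := by
  rw [twistedHom, ← MonoidHom.eval_apply_apply, map_list_prod, List.map_map]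
  congr 1
  refine List.map_congr_left fun m _ => ?_
  simp [pow_mul]

theorem twistedHom_eq_one {k M : Type*} [Field k] [Field M] [Algebra k M] {R : ℕ}
    {ψ : ℕ → 𝓞 M →+* ZMod R} {E : ℕ} {e : List ℕ} {y : 𝓞 k}
    (h : ∀ m, ψ m (algebraMap (𝓞 k) (𝓞 M) y) ^ E = 1) : twistedHom ψ E e y = 1 := by
  rw [twistedHom_apply]
  refine List.prod_eq_one fun x hx => ?_
  obtain ⟨m, -, rfl⟩ := List.mem_map.mp hx
  rw [h, one_pow]

theorem twistedHom_pow_eq_one {k M : Type*} [Field k] [Field M] [Algebra k M] {R : ℕ}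
    {ψ : ℕ → 𝓞 M →+* ZMod R} {E p : ℕ} (hE : E * p = R.totient) {e : List ℕ} {y : 𝓞 k}
    (hy : ∀ m, IsUnit (ψ m (algebraMap (𝓞 k) (𝓞 M) y))) : twistedHom ψ E e y ^ p = 1 := by
  rw [← map_pow]
  refine twistedHom_eq_one fun m => ?_
  rw [map_pow, map_pow, ← pow_mul, mul_comm, hE, ← (hy m).unit_spec, ← Units.val_pow_eq_pow_val,
    ZMod.pow_totient, Units.val_one]

theorem twistedHom_norm_evalList {k M : Type*} [Field k] [Field M]
    [Algebra k M] [IsCyclotomicExtension {125} k M] [FiniteDimensional k M] [IsGalois k M]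
    {ζ : 𝓞 M} (hζ : IsPrimitiveRoot (ζ : M) 125) (hdeg : Module.finrank k M = 4)
    {R s : ℕ} [NeZero R] (hs : s ^ 125 % R = 1) {ψ : ℕ → 𝓞 M →+* ZMod R}
    (hψ : ∀ m, ψ m ζ = s ^ 2 ^ m) {E : ℕ} (e : List ℕ) {l : List ℤ} {i N : ℕ} (hi : i + 24 < N)
    {D : List ℕ} (hD : ∀ n < N, normResidue R s l n ^ E % R = D.getD (n % 25) 0) :
    twistedHom ψ E e (RingOfIntegers.norm k (evalList l (ζ ^ 2 ^ i))) =
      (twistedProd R D e i : ZMod R) := by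
  have hs' : (s : ZMod R) ^ 125 = 1 := by
    rw [← Nat.cast_pow, ← ZMod.natCast_mod, hs, Nat.cast_one]
  rw [twistedHom_apply, twistedProd, ZMod.natCast_mod, Nat.cast_list_prod, List.map_map]
  congr 1
  refine List.map_congr_left fun m hm => ?_
  have hm := List.mem_range.mp hm
  rw [map_norm_evalList_eq_normResidue hζ hdeg hs' (ψ m) (hψ m), Function.comp_apply,
    ← hD (m + i) (by omega)]
  simp

theorem twistedProd_natCast_eq_one {R : ℕ} (hR : 1 < R) (D e : List ℕ) (i : ℕ) :
    (twistedProd R D e i : ZMod R) = 1 ↔ twistedProd R D e i = 1 := by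
  rw [← Nat.cast_one, ZMod.natCast_eq_natCast_iff', Nat.mod_eq_of_lt hR, twistedProd, Nat.mod_mod]

theorem elementCoeffs_dvd {M : Type*} [Field M] {ζ : 𝓞 M} (hζ : IsPrimitiveRoot (ζ : M) 125) :
    evalList elementCoeffs ζ ∣ (splitPrime : 𝓞 M) := by
  have hζ' : IsPrimitiveRoot ζ 125 := hζ.of_map_of_injective RingOfIntegers.coe_injective
  refine ⟨evalList cofactorCoeffs ζ, ?_⟩
  rw [← evalList_mulList, mulList_elementCoeffs, evalList_addList, evalList_mulList,
    evalList_cyclotomicCoeffs, hζ'.sum_pow_eq_zero]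
  simp [evalList]

theorem dvd_exponents_of_prod_pow_eq_pow {k M : Type*} [Field k] [Field M] [NumberField M]
    [Algebra k M] [IsCyclotomicExtension {125} ℚ M] [IsCyclotomicExtension {125} k M]
    [FiniteDimensional k M] [IsGalois k M]
    {ζ : 𝓞 M} (hζ : IsPrimitiveRoot (ζ : M) 125) (hdeg : Module.finrank k M = 4)
    (c : Fin 24 → (𝓞 k)ˣ)
    (hc : ∀ i, (c i : 𝓞 k) = RingOfIntegers.norm k (evalList [1, 1] (ζ ^ 2 ^ (i : ℕ))))
    {n : Fin 24 → ℕ} {v : (𝓞 k)ˣ} (h : ∏ i, c i ^ n i = v ^ 2251) (m : Fin 24) :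
    2251 ∣ n m := by
  have hprime : Nat.Prime 2251001 := by norm_num
  choose ψ hψ using RingOfIntegers.exists_ringHom_zmod_pow hζ (R := 2251001) (s := 1843624)
    (by decide +kernel)
  let X : 𝓞 k →* ZMod 2251001 := twistedHom ψ 1000 (dualExponents m)
  have hX (i : Fin 24) : X (c i) = 1 ↔ (i : ℕ) ≠ m := by
    rw [hc, twistedHom_norm_evalList (N := 49) hζ hdeg (by decide +kernel) hψ _ (by omega)
      normResidue_aux, twistedProd_natCast_eq_one (by norm_num),
      twistedProd_aux m m.isLt i i.isLt]
  have hpow (w : (𝓞 k)ˣ) : X w ^ 2251 = 1 := by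
    refine twistedHom_pow_eq_one (by rw [Nat.totient_prime hprime]) fun j => ?_
    exact (w.isUnit.map (algebraMap (𝓞 k) (𝓞 M))).map (ψ j)
  have h1 : X (c m) ^ n m = 1 := by
    have h2 := congrArg (fun w : (𝓞 k)ˣ => X w) h
    simp only [Units.coe_prod, Units.val_pow_eq_pow_val, map_prod, map_pow, hpow] at h2
    rwa [Finset.prod_eq_single m (fun i _ him => by
      rw [(hX i).mpr (Fin.val_ne_of_ne him), one_pow]) (by simp)] at h2
  have h2 : orderOf (X (c m)) = 2251 := by
    have : Fact (Nat.Prime 2251) := ⟨by norm_num⟩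
    exact orderOf_eq_prime (hpow _) fun h => (hX m).mp h rfl
  exact h2 ▸ orderOf_dvd_of_pow_eq_one h1

theorem dvd_card_classGroup {k M K A : Type*} [Field k] [NumberField k] [Field M] [NumberField M]
    [Field K] [NumberField K] [Field A] [NumberField A]
    [Algebra k M] [Algebra k K] [Algebra k A] [Algebra M A] [Algebra K A] [IsScalarTower k M A]
    [IsScalarTower k K A] [IsCyclotomicExtension {125} ℚ M] [IsCyclotomicExtension {125} k M]
    [IsCyclotomicExtension {2251 ^ 2} M A] (hk : Module.finrank ℚ k = 25)
    (hkM : Module.finrank k M = 4) (hMA : Module.finrank M A = (2251 ^ 2).totient)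
    (hKA : (Module.finrank K A).Coprime 2251) {ζ : 𝓞 M} (hζ : IsPrimitiveRoot (ζ : M) 125)
    {ξ : A} (hξ : IsPrimitiveRoot ξ (2251 ^ 2)) {ω : 𝓞 A} (hω : Algebra.adjoin ℤ {ω} = ⊤)
    (hωξ : (ω : A) = algebraMap M A ζ * ξ)
    (hK : ∀ x : 𝓞 K, (splitPrime : 𝓞 K) ∣ x ^ splitPrime - x) :
    2251 ∣ Nat.card (ClassGroup (𝓞 K)) := by
  have hp : Nat.Prime 2251 := by norm_num
  have := Fact.mk hp
  have : FiniteDimensional k M := Module.finite_of_finrank_eq_succ hkM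
  have : FiniteDimensional k A := Module.Finite.trans (R := k) M A
  have hGal : IsGalois k M := IsCyclotomicExtension.isGalois {125} k M
  have hζ' : IsPrimitiveRoot ζ 125 := hζ.of_map_of_injective RingOfIntegers.coe_injective
  choose ψ hψ using RingOfIntegers.exists_ringHom_zmod_pow hζ (R := 2251 ^ 2) (s := 3550855)
    (by decide +kernel)
  let X : 𝓞 k →* ZMod (2251 ^ 2) := twistedHom ψ 2250 characterValues
  have hX (l : List ℤ) {i N : ℕ} (hi : i + 24 < N) {D : List ℕ}
      (hD : ∀ n < N, normResidue (2251 ^ 2) 3550855 l n ^ 2250 % 2251 ^ 2 = D.getD (n % 25) 0) :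
      X (RingOfIntegers.norm k (evalList l (ζ ^ 2 ^ i))) = 1 ↔
        twistedProd (2251 ^ 2) D characterValues i = 1 := by
    rw [twistedHom_norm_evalList hζ hkM (by decide +kernel) hψ _ hi hD,
      twistedProd_natCast_eq_one (by norm_num)]
  have htot : 2250 * 2251 = (2251 ^ 2).totient := by
    rw [Nat.totient_prime_pow hp (by norm_num)]
    norm_num
  let δ : 𝓞 k := RingOfIntegers.norm k (evalList elementCoeffs (ζ ^ 2 ^ 0))
  have hδ : δ ∣ (splitPrime : 𝓞 k) ^ 4 := by
    have h := map_dvd (RingOfIntegers.norm k) (elementCoeffs_dvd hζ)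
    rw [← map_natCast (algebraMap (𝓞 k) (𝓞 M)), RingOfIntegers.norm_algebraMap, hkM] at h
    simpa [δ] using h
  have hXδ : X δ ≠ 1 := (hX _ (by norm_num) normResidue_element).not.mpr twistedProd_element
  have hcop : splitPrime.Coprime (2251 ^ 2) := by
    refine Nat.Coprime.pow_right 2 (((Nat.coprime_primes prime_splitPrime hp).mpr ?_))
    decide +kernel
  have hunit (b j : ℕ) {x : 𝓞 k} (hx : x ∣ (splitPrime : 𝓞 k) ^ b) :
      IsUnit (ψ j (algebraMap (𝓞 k) (𝓞 M) x)) := by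
    refine isUnit_of_dvd_unit (map_dvd (ψ j) (map_dvd (algebraMap (𝓞 k) (𝓞 M)) hx)) ?_
    simpa using ((ZMod.isUnit_iff_coprime splitPrime (2251 ^ 2)).mpr hcop).pow b
  obtain ⟨u, γ, b, hγ, hu⟩ :=
    NumberField.exists_pow_card_classGroup_eq prime_splitPrime hK δ hδ
  have hXγ : X (RingOfIntegers.norm k γ) = 1 := by
    refine twistedHom_eq_one fun j => ?_
    have h1 := map_norm_pow_eq_one (k := k) hMA hξ ζ hω hωξ (ψ j) γ (hcop.pow_left b) hγ
    have hγ' : RingOfIntegers.norm k γ ∣ (splitPrime : 𝓞 k) ^ (b * Module.finrank k K) := by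
      have h := map_dvd (RingOfIntegers.norm k) hγ
      rw [← map_natCast (algebraMap (𝓞 k) (𝓞 K)), RingOfIntegers.norm_algebraMap] at h
      rw [pow_mul]
      simpa using h
    have h2 : ψ j (algebraMap (𝓞 k) (𝓞 M) (RingOfIntegers.norm k γ)) ^ (2250 * 2251) = 1 := by
      rw [htot, ← (hunit _ j hγ').unit_spec, ← Units.val_pow_eq_pow_val, ZMod.pow_totient,
        Units.val_one]
    rw [← orderOf_dvd_iff_pow_eq_one] at h1 h2 ⊢
    refine Nat.Coprime.dvd_of_dvd_mul_right (Nat.Coprime.of_dvd_left h1 ?_) h2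
    exact Nat.Coprime.mul_left (by norm_num) hKA
  have hXpow {b : ℕ} {x : 𝓞 k} (hx : x ∣ (splitPrime : 𝓞 k) ^ b) : X x ^ 2251 = 1 :=
    twistedHom_pow_eq_one htot fun j => hunit b j hx
  have hXunit (w : (𝓞 k)ˣ) : X w ^ 2251 = 1 := hXpow (b := 0) (by simp)
  have hcunit (i : Fin 24) :
      IsUnit (RingOfIntegers.norm k (evalList [1, 1] (ζ ^ 2 ^ (i : ℕ)))) := by
    refine IsUnit.map _ ?_
    have := (hζ'.pow_of_coprime (2 ^ (i : ℕ))
      (Nat.Coprime.pow_left _ (by norm_num))).isUnit_one_add (by decide) (by norm_num)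
    simpa [evalList] using this
  let c (i : Fin 24) : (𝓞 k)ˣ := (hcunit i).unit
  have hXc (i : Fin 24) : X (c i) = 1 :=
    (hX _ (by omega) normResidue_unit).mpr (twistedProd_unit i i.isLt)
  obtain ⟨n, ⟨i, hi⟩, v, hv⟩ := NumberField.Units.exists_prod_pow_eq_pow (p := 2251)
    (by rw [hk]; decide) (by decide) (ι := Option (Fin 24)) (by rw [hk]; simp)
    (fun j => j.elim u c)
  simp only [Fintype.prod_option, Option.elim] at hv
  have hXu : X u = 1 := by
    by_cases hn : 2251 ∣ n none
    · exfalso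
      obtain ⟨t, ht⟩ := hn
      have h1 := dvd_exponents_of_prod_pow_eq_pow hζ hkM c (fun _ => rfl)
        (n := fun j => n (some j)) (v := v * (u ^ t)⁻¹) (by
          rw [mul_pow, ← hv, ht, inv_pow, ← pow_mul, mul_comm t]
          exact (mul_inv_cancel_comm _ _).symm)
      cases i with
      | none => exact hi ⟨t, ht⟩
      | some j => exact hi (h1 j)
    · have h1 : X u ^ n none = 1 := by
        have h2 := congrArg (fun w : (𝓞 k)ˣ => X w) hv
        simpa [hXc, hXunit] using h2
      have h3 := pow_gcd_eq_one.mpr ⟨h1, hXunit u⟩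
      rwa [((Nat.Prime.coprime_iff_not_dvd hp).mpr hn).symm, pow_one] at h3
  by_contra hh
  have h1 : X δ ^ Nat.card (ClassGroup (𝓞 K)) = 1 := by
    rw [← map_pow, hu, map_mul, hXu, hXγ, one_mul]
  have h3 := pow_gcd_eq_one.mpr ⟨h1, hXpow hδ⟩
  rw [((Nat.Prime.coprime_iff_not_dvd hp).mpr hh).symm, pow_one] at h3
  exact hXδ h3

theorem IsCyclotomicExtension.tower_top_of_adjoin_le (n : ℕ) [NeZero n] {A B C : Type*} [CommRing A]
    [CommRing B] [CommRing C] [Algebra A B] [Algebra A C] [Algebra B C] [IsScalarTower A B C]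
    {ω : C} (hω : Algebra.adjoin A {ω} = ⊤) {ξ : C} (hξ : IsPrimitiveRoot ξ n) {b : B}
    (h : ω = algebraMap B C b * ξ) : IsCyclotomicExtension {n} B C where
  exists_isPrimitiveRoot := by
    rintro _ rfl _
    exact ⟨ξ, hξ⟩
  adjoin_roots x := by
    have hmem : ω ∈ Algebra.adjoin B {b : C | ∃ m ∈ ({n} : Set ℕ), m ≠ 0 ∧ b ^ m = 1} := by
      rw [h]
      exact mul_mem (Subalgebra.algebraMap_mem _ b)
        (Algebra.subset_adjoin ⟨n, rfl, NeZero.ne n, hξ.pow_eq_one⟩)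
    have hle : Algebra.adjoin A {ω} ≤
        (Algebra.adjoin B {b : C | ∃ m ∈ ({n} : Set ℕ), m ≠ 0 ∧ b ^ m = 1}).restrictScalars A :=
      Algebra.adjoin_le (Set.singleton_subset_iff.mpr hmem)
    exact hle (hω ▸ Algebra.mem_top)

theorem Subgroup.mem_of_coprime_pow_mem {G : Type*} [Group G] (H : Subgroup G) {g : G} {a b : ℕ}
    (hab : a.Coprime b) (ha : g ^ a ∈ H) (hb : g ^ b ∈ H) : g ∈ H := by
  have h := Nat.gcd_eq_gcd_ab a b
  rw [hab.gcd_eq_one, Nat.cast_one] at h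
  rw [← zpow_one g, h, zpow_add, zpow_mul, zpow_mul, zpow_natCast, zpow_natCast]
  exact mul_mem (zpow_mem ha _) (zpow_mem hb _)

theorem IntermediateField.mem_fixingSubgroup_of_pow_mem {E A : Type*} [Field E] [Field A]
    [Algebra E A] [FiniteDimensional E A] [IsAbelianGalois E A] (F : IntermediateField E A)
    {σ : Gal(A/E)} {q : ℕ} (hq : q.Coprime (Module.finrank E F)) (h : σ ^ q ∈ F.fixingSubgroup) :
    σ ∈ F.fixingSubgroup := by
  refine Subgroup.mem_of_coprime_pow_mem _ hq h ?_
  rw [IntermediateField.finrank_eq_fixingSubgroup_index]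
  have : F.fixingSubgroup.Normal := inferInstance
  exact Subgroup.pow_index_mem _ σ

theorem IsCyclotomicExtension.Rat.exists_algEquiv_pow {A : Type*} [Field A] [NumberField A]
    (n : ℕ) [NeZero n] [IsCyclotomicExtension {n} ℚ A] {r : ℕ} (hr : r.Coprime n) :
    ∃ σ : Gal(A/ℚ), ∀ x : A, x ^ n = 1 → σ x = x ^ r := by
  refine ⟨(IsCyclotomicExtension.Rat.galEquivZMod n A).symm (ZMod.unitOfCoprime r hr),
    fun x hx => ?_⟩
  rw [IsCyclotomicExtension.Rat.galEquivZMod_apply_of_pow_eq n A _ hx, MulEquiv.apply_symm_apply,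
    ZMod.coe_unitOfCoprime, ZMod.val_natCast]
  conv_rhs => rw [← Nat.div_add_mod r n, pow_add, pow_mul, hx, one_pow, one_mul]

theorem dvd_card_classGroup_of_algHom {k M K A : Type*} [Field k] [NumberField k] [Field M]
    [NumberField M] [Field K] [NumberField K] [Field A] [NumberField A]
    [Algebra k M] [Algebra k K] [Algebra k A] [Algebra M A] [Algebra K A] [IsScalarTower k M A]
    [IsScalarTower k K A] [IsCyclotomicExtension {125} ℚ M]
    [IsCyclotomicExtension {125 * 2251 ^ 2} ℚ A] (hk : Module.finrank ℚ k = 25)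
    (hK : 2251 ∣ Module.finrank ℚ K) {ζ : M} (hζ : IsPrimitiveRoot ζ 125)
    {ξ : A} (hξ : IsPrimitiveRoot ξ (2251 ^ 2)) {ω : A} (hωξ : ω = algebraMap M A ζ * ξ)
    (hω : IsPrimitiveRoot ω (125 * 2251 ^ 2)) (σ : A →ₐ[K] A) (hσ : σ ω = ω ^ splitPrime) :
    2251 ∣ Nat.card (ClassGroup (𝓞 K)) := by
  have hp : Nat.Prime 2251 := by norm_num
  have : NeZero (125 * 2251 ^ 2) := ⟨by norm_num⟩
  have hcM : IsCyclotomicExtension {125} k M :=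
    IsCyclotomicExtension.tower_top_of_adjoin_le 125 (b := 1)
      (IsCyclotomicExtension.adjoin_primitive_root_eq_top (A := ℚ) hζ) hζ (by simp)
  have hcA : IsCyclotomicExtension {2251 ^ 2} M A :=
    IsCyclotomicExtension.tower_top_of_adjoin_le (2251 ^ 2) (b := ζ)
      (IsCyclotomicExtension.adjoin_primitive_root_eq_top (A := ℚ) hω) hξ hωξ
  have htot : (2251 ^ 2).totient = 2251 * 2250 := by
    rw [Nat.totient_prime_pow hp (by norm_num)]
    norm_num
  have hdM : Module.finrank ℚ M = 100 := by
    rw [IsCyclotomicExtension.Rat.finrank 125 M, show 125 = 5 ^ 3 by norm_num,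
      Nat.totient_prime_pow Nat.prime_five (by norm_num)]
    norm_num
  have hdA : Module.finrank ℚ A = 100 * (2251 ^ 2).totient := by
    rw [IsCyclotomicExtension.Rat.finrank (125 * 2251 ^ 2) A, Nat.totient_mul (by norm_num),
      show 125 = 5 ^ 3 by norm_num, Nat.totient_prime_pow Nat.prime_five (by norm_num)]
    norm_num
  have hkM : Module.finrank k M = 4 := by
    have := Module.finrank_mul_finrank ℚ k M
    rw [hk, hdM] at this
    omega
  have hdMA : Module.finrank M A = (2251 ^ 2).totient := by
    have := Module.finrank_mul_finrank ℚ M A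
    rw [hdM, hdA] at this
    exact Nat.eq_of_mul_eq_mul_left (by norm_num) this
  have hdKA : (Module.finrank K A).Coprime 2251 := by
    rw [Nat.coprime_comm, hp.coprime_iff_not_dvd]
    intro hdvd
    have h := mul_dvd_mul hK hdvd
    rw [Module.finrank_mul_finrank ℚ K A, hdA, htot] at h
    revert h
    norm_num
  have htop := IsCyclotomicExtension.Rat.adjoin_singleton_eq_top hω
  exact dvd_card_classGroup (k := k) hk hkM hdMA hdKA (ζ := hζ.toInteger) hζ hξ htop hωξ
    fun x => RingOfIntegers.natCast_dvd_pow_sub_self prime_splitPrime htop σ hσ x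

theorem dvd_card_classGroup_sup {L : Type*} [Field L] [CharZero L]
    (K₁ K₂ : IntermediateField ℚ L) {ζ : L} (hζ : IsPrimitiveRoot ζ 125)
    (hK₁ : K₁ ≤ IntermediateField.adjoin ℚ {ζ}) (hd₁ : Module.finrank ℚ K₁ = 25)
    {ξ : L} (hξ : IsPrimitiveRoot ξ (2251 ^ 2))
    (hK₂ : K₂ ≤ IntermediateField.adjoin ℚ {ξ}) (hd₂ : Module.finrank ℚ K₂ = 2251) :
    2251 ∣ Nat.card (ClassGroup (𝓞 ↥(K₁ ⊔ K₂))) := by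
  have hω : IsPrimitiveRoot (ζ * ξ) (125 * 2251 ^ 2) := by
    rw [IsPrimitiveRoot.iff_orderOf, (Commute.all ζ ξ).orderOf_mul_eq_mul_orderOf_of_coprime,
      ← hζ.eq_orderOf, ← hξ.eq_orderOf]
    rw [← hζ.eq_orderOf, ← hξ.eq_orderOf]
    norm_num
  set M := IntermediateField.adjoin ℚ {ζ} with hM
  set A := IntermediateField.adjoin ℚ {ζ * ξ} with hA
  set K := K₁ ⊔ K₂ with hK
  have : NeZero (125 * 2251 ^ 2) := ⟨by norm_num⟩
  have hcM : IsCyclotomicExtension {125} ℚ M :=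
    (IntermediateField.isCyclotomicExtension_singleton_iff_eq_adjoin 125 ℚ L M hζ).mpr hM
  have hcA : IsCyclotomicExtension {125 * 2251 ^ 2} ℚ A :=
    (IntermediateField.isCyclotomicExtension_singleton_iff_eq_adjoin _ ℚ L A hω).mpr hA
  have hnM : NumberField M := IsCyclotomicExtension.numberField {125} ℚ M
  have hnA : NumberField A := IsCyclotomicExtension.numberField {125 * 2251 ^ 2} ℚ A
  have hmem {x : L} (hx : x ^ (125 * 2251 ^ 2) = 1) : x ∈ A := by
    obtain ⟨i, -, rfl⟩ := hω.eq_pow_of_pow_eq_one hx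
    exact pow_mem (IntermediateField.mem_adjoin_simple_self ℚ _) i
  have hζn : ζ ^ (125 * 2251 ^ 2) = 1 := by rw [pow_mul, hζ.pow_eq_one, one_pow]
  have hξn : ξ ^ (125 * 2251 ^ 2) = 1 := by rw [mul_comm, pow_mul, hξ.pow_eq_one, one_pow]
  have hMA : M ≤ A := IntermediateField.adjoin_simple_le_iff.mpr (hmem hζn)
  have hK₁A : K₁ ≤ A := hK₁.trans hMA
  have hK₂A : K₂ ≤ A := hK₂.trans (IntermediateField.adjoin_simple_le_iff.mpr (hmem hξn))
  have hKA : K ≤ A := sup_le hK₁A hK₂A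
  have hK₁K : K₁ ≤ K := le_sup_left
  have hK₂K : K₂ ≤ K := le_sup_right
  have hn₁ : NumberField K₁ :=
    { to_finiteDimensional := Module.finite_of_finrank_eq_succ hd₁ }
  have hnK : NumberField K :=
    { to_finiteDimensional := by
        have : FiniteDimensional ℚ K₂ := Module.finite_of_finrank_eq_succ hd₂
        exact IntermediateField.finiteDimensional_sup K₁ K₂ }
  let := (IntermediateField.inclusion hK₁).toAlgebra
  let := (IntermediateField.inclusion hK₁K).toAlgebra
  let := (IntermediateField.inclusion hK₁A).toAlgebra
  let := (IntermediateField.inclusion hMA).toAlgebra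
  let := (IntermediateField.inclusion hKA).toAlgebra
  have : IsScalarTower K₁ M A := IsScalarTower.of_algebraMap_eq fun _ => rfl
  have : IsScalarTower K₁ K A := IsScalarTower.of_algebraMap_eq fun _ => rfl
  let ζM : M := ⟨ζ, IntermediateField.mem_adjoin_simple_self ℚ ζ⟩
  let ξA : A := ⟨ξ, hmem hξn⟩
  let ωA : A := ⟨ζ * ξ, IntermediateField.mem_adjoin_simple_self ℚ _⟩
  have hζM : IsPrimitiveRoot ζM 125 := hζ.of_map_of_injective M.val.injective
  have hξA : IsPrimitiveRoot ξA (2251 ^ 2) := hξ.of_map_of_injective A.val.injective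
  have hωA : IsPrimitiveRoot ωA (125 * 2251 ^ 2) := hω.of_map_of_injective A.val.injective
  obtain ⟨σ, hσ⟩ := IsCyclotomicExtension.Rat.exists_algEquiv_pow (A := A) (125 * 2251 ^ 2)
    (r := splitPrime) (by decide +kernel)
  have hfix {η : A} {τ : Gal(A/ℚ)} (hτ : τ η = η) {x : A}
      (hx : (x : L) ∈ IntermediateField.adjoin ℚ {(η : L)}) : τ x = x := by
    have hle : IntermediateField.adjoin ℚ {(η : L)} ≤ A :=
      IntermediateField.adjoin_simple_le_iff.mpr η.2
    have h : (A.val.comp τ.toAlgHom).comp (IntermediateField.inclusion hle) =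
        (IntermediateField.adjoin ℚ {(η : L)}).val := by
      refine IntermediateField.adjoin_algHom_ext ℚ ?_
      rintro _ rfl
      exact congrArg (Subtype.val) hτ
    have hτx := DFunLike.congr_fun h (⟨x, hx⟩ : IntermediateField.adjoin ℚ {(η : L)})
    exact Subtype.ext hτx
  have hσ₁ (x : A) (hx : (x : L) ∈ K₁) : σ x = x := by
    refine hfix (η := ⟨ζ, hmem hζn⟩) ?_ (hK₁ hx)
    refine (hσ _ (Subtype.ext hζn)).trans (Subtype.ext ?_)
    change ζ ^ splitPrime = ζ
    rw [← Nat.div_add_mod splitPrime 125, splitPrime_mod, pow_succ, pow_mul, hζ.pow_eq_one,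
      one_pow, one_mul]
  have hσ₂ (x : A) (hx : (x : L) ∈ K₂) : σ x = x := by
    have : IsAbelianGalois ℚ A :=
      IsCyclotomicExtension.isAbelianGalois {125 * 2251 ^ 2} ℚ A
    let F : IntermediateField ℚ A := IntermediateField.restrict hK₂A
    have hF : Module.finrank ℚ F = 2251 :=
      (IntermediateField.restrictAlgEquiv hK₂A).toLinearEquiv.finrank_eq.symm.trans hd₂
    have hpow (j : ℕ) : (σ ^ j) ξA = ξA ^ splitPrime ^ j := by
      induction j with
      | zero => simp
      | succ j ih =>
        rw [pow_succ', AlgEquiv.mul_apply, ih, map_pow, hσ _ (Subtype.ext hξn), ← pow_mul,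
          pow_succ']
    have hmemF : σ ∈ F.fixingSubgroup := by
      refine F.mem_fixingSubgroup_of_pow_mem (q := 2250) (by rw [hF]; norm_num) ?_
      rw [IntermediateField.mem_fixingSubgroup_iff]
      intro y hy
      refine hfix (η := ξA) ?_ (hK₂ ((IntermediateField.mem_restrict hK₂A y).mp hy))
      rw [hpow, ← Nat.div_add_mod (splitPrime ^ 2250) (2251 ^ 2), splitPrime_pow_mod, pow_succ,
        pow_mul, hξA.pow_eq_one, one_pow, one_mul]
    exact (IntermediateField.mem_fixingSubgroup_iff _ _).mp hmemF x
      ((IntermediateField.mem_restrict hK₂A x).mpr hx)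
  have hσK (x : K) : σ (algebraMap K A x) = algebraMap K A x := by
    have h : (A.val.comp σ.toAlgHom).comp (IntermediateField.inclusion hKA) = K.val := by
      refine IntermediateField.algHom_ext_of_eq_adjoin ℚ (IntermediateField.sup_def K₁ K₂) ?_
      rintro x (hx | hx)
      · exact congrArg Subtype.val (hσ₁ ⟨x, hK₁A hx⟩ hx)
      · exact congrArg Subtype.val (hσ₂ ⟨x, hK₂A hx⟩ hx)
    exact Subtype.ext (DFunLike.congr_fun h x)
  let σK : A →ₐ[K] A := { (σ : A →+* A) with commutes' := hσK }
  exact dvd_card_classGroup_of_algHom (k := K₁) hd₁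
    (hd₂ ▸ IntermediateField.finrank_dvd_of_le_right hK₂K) hζM hξA rfl hωA σK
    (hσ _ hωA.pow_eq_one)

/-- `2251` divides the class number of the compositum `ℚ(5²)·ℚ(2251)`, where `ℚ(5²)` is the
unique subfield of degree `25` of `ℚ(ζ_{5³})` (the `2`-nd layer of the cyclotomic
`ℤ₅`-extension of `ℚ`) and `ℚ(2251)` is the unique degree-`2251` subfield of `ℚ(ζ_{2251²})`,
the compositum being taken inside `ℂ`. -/
theorem p2251_dvd_classNumber
    (K₁ K₂ : IntermediateField ℚ ℂ)
    (ζ : ℂ) (hζ : IsPrimitiveRoot ζ (5 ^ 3))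
    (hK₁sub : K₁ ≤ IntermediateField.adjoin ℚ {ζ})
    (hK₁deg : Module.finrank ℚ K₁ = 5 ^ 2)
    (ξ : ℂ) (hξ : IsPrimitiveRoot ξ (2251 ^ 2))
    (hK₂sub : K₂ ≤ IntermediateField.adjoin ℚ {ξ})
    (hK₂deg : Module.finrank ℚ K₂ = 2251) :
    2251 ∣ Nat.card (ClassGroup (𝓞 ↥(K₁ ⊔ K₂))) :=
  dvd_card_classGroup_sup K₁ K₂ hζ hK₁sub hK₁deg hξ hK₂sub hK₂deg
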